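/- arXiv:1810.12209 — 3 statements merged into one kernel-verified Lean document; each statement's English description precedes it below -/
import Mathlib

section
/- Let u : [0,∞) → ℝ be continuous with u(0) ≥ 0. Define the regulator v(t) = sup_{s ∈ [0,t]} max(−u(s), 0) and the reflected path w(t) = u(t) + v(t). Then v is continuous and nondecreasing, v(0) = 0, and w(t) ≥ 0 for all t ≥ 0. -/
open Set

lemma bddAbove_image_Icc_of_continuousOn_Ici {f : ℝ → ℝ} {a : ℝ} (hf : ContinuousOn f (Ici a))
    (t : ℝ) : BddAbove (f '' Icc a t) :=
  isCompact_Icc.bddAbove_image (hf.mono Icc_subset_Ici_self)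

lemma le_sSup_image_Icc {f : ℝ → ℝ} {a s t : ℝ} (hf : ContinuousOn f (Ici a))
    (hs : s ∈ Icc a t) : f s ≤ sSup (f '' Icc a t) :=
  le_csSup (bddAbove_image_Icc_of_continuousOn_Ici hf t) (mem_image_of_mem f hs)

lemma monotoneOn_sSup_image_Icc {f : ℝ → ℝ} {a : ℝ} (hf : ContinuousOn f (Ici a)) :
    MonotoneOn (fun t => sSup (f '' Icc a t)) (Ici a) := fun _ hx y _ hxy =>
  csSup_le_csSup (bddAbove_image_Icc_of_continuousOn_Ici hf y)
    ((nonempty_Icc.2 hx).image f) (image_mono (Icc_subset_Icc_right hxy))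

/-- The running supremum grows over `[x, y]` by at most the oscillation of `f` there. -/
lemma sSup_image_Icc_le_add {f : ℝ → ℝ} {a x y ε : ℝ} (hf : ContinuousOn f (Ici a))
    (hx : a ≤ x) (hxy : x ≤ y) (hε : 0 ≤ ε) (h : ∀ s ∈ Icc x y, f s ≤ f x + ε) :
    sSup (f '' Icc a y) ≤ sSup (f '' Icc a x) + ε := by
  refine csSup_le ((nonempty_Icc.2 (hx.trans hxy)).image f) ?_
  rintro _ ⟨s, hs, rfl⟩
  rcases le_total s x with hsx | hxs
  · linarith [le_sSup_image_Icc hf (⟨hs.1, hsx⟩ : s ∈ Icc a x)]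
  · linarith [h s ⟨hxs, hs.2⟩, le_sSup_image_Icc hf (right_mem_Icc.2 hx)]

/-- The running supremum of a continuous function is continuous. -/
lemma continuousOn_sSup_image_Icc {f : ℝ → ℝ} {a : ℝ} (hf : ContinuousOn f (Ici a)) :
    ContinuousOn (fun t => sSup (f '' Icc a t)) (Ici a) := by
  rw [Metric.continuousOn_iff]
  intro t ht ε hε
  obtain ⟨δ, hδ, h⟩ := Metric.continuousOn_iff.1 hf t ht (ε / 4) (by positivity)
  refine ⟨δ, hδ, fun x hx hxt => ?_⟩
  simp only [Real.dist_eq, abs_lt, mem_Ici] at h hxt ht hx ⊢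
  rcases le_total x t with hle | hle
  · have hinc := sSup_image_Icc_le_add (ε := ε / 2) hf hx hle (by positivity) fun s hs => by
      have h₁ := h s (hx.trans hs.1) ⟨by linarith [hs.1], by linarith [hs.2]⟩
      linarith [h₁.2, (h x hx hxt).1]
    have hmono := monotoneOn_sSup_image_Icc hf hx ht hle
    dsimp only at hmono
    constructor <;> linarith
  · have hinc := sSup_image_Icc_le_add (ε := ε / 2) hf ht hle (by positivity) fun s hs => by
      have h₁ := h s (ht.trans hs.1) ⟨by linarith [hs.1], by linarith [hs.2]⟩
      linarith [h₁.2]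
    have hmono := monotoneOn_sSup_image_Icc hf ht hx hle
    dsimp only at hmono
    constructor <;> linarith

/-- **One-dimensional Skorohod reflection, basic properties.**
Let `u : [0,∞) → ℝ` be continuous with `u 0 ≥ 0`.  Define the regulator
`v t = sup_{s ∈ [0,t]} max (−u s) 0` and the reflected path `w t = u t + v t`.
Then `v` is continuous and nondecreasing on `[0,∞)`, `v 0 = 0`, and `w t ≥ 0`
for all `t ≥ 0`. -/
theorem skorohod_reflection_basic_properties
    (u v w : ℝ → ℝ)
    (hu : ContinuousOn u (Ici 0)) (hu0 : 0 ≤ u 0)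
    (hv : ∀ t, v t = sSup ((fun s => max (-u s) 0) '' Icc 0 t))
    (hw : ∀ t, w t = u t + v t) :
    ContinuousOn v (Ici 0) ∧ MonotoneOn v (Ici 0) ∧ v 0 = 0 ∧
      ∀ t, 0 ≤ t → 0 ≤ w t := by
  have hf : ContinuousOn (fun s => max (-u s) 0) (Ici 0) := ContinuousOn.sup hu.neg continuousOn_const
  obtain rfl : v = fun t => sSup ((fun s => max (-u s) 0) '' Icc 0 t) := funext hv
  refine ⟨continuousOn_sSup_image_Icc hf, monotoneOn_sSup_image_Icc hf, ?_, fun t ht => ?_⟩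
  · simp [hu0]
  · have hneg : -u t ≤ sSup ((fun s => max (-u s) 0) '' Icc 0 t) :=
      (le_max_left _ _).trans (le_sSup_image_Icc hf (right_mem_Icc.2 ht))
    rw [hw]
    linarith
end

section
/- Let u : [0,∞) → ℝ be continuous with u(0) ≥ 0, let v(t) = sup_{s ∈ [0,t]} max(−u(s), 0) and w(t) = u(t) + v(t). If 0 ≤ a ≤ b and w(s) > 0 for every s ∈ [a,b], then v(b) = v(a). In particular, no time t at which w(t) > 0 is a point of increase of v. -/
open Set

/-- **Complementarity of the Skorohod regulator.**
Let `u : [0,∞) → ℝ` be continuous with `u 0 ≥ 0`, let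
`v t = sup_{s ∈ [0,t]} max (−u s) 0` and `w t = u t + v t`.
If `0 ≤ a ≤ b` and `w s > 0` for every `s ∈ [a,b]`, then `v b = v a`;
in particular `v` does not increase at times where `w` is strictly positive. -/
theorem skorohod_regulator_flat_when_reflected_positive
    (u v w : ℝ → ℝ)
    (hu : ContinuousOn u (Ici 0)) (hu0 : 0 ≤ u 0)
    (hv : ∀ t, v t = sSup ((fun s => max (-u s) 0) '' Icc 0 t))
    (hw : ∀ t, w t = u t + v t)
    (a b : ℝ) (ha : 0 ≤ a) (hab : a ≤ b)
    (hpos : ∀ s ∈ Icc a b, 0 < w s) :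
    v b = v a := by
  set f : ℝ → ℝ := fun s => max (-u s) 0
  have hb : 0 ≤ b := ha.trans hab
  have hfc : ContinuousOn f (Icc 0 b) :=
    (hu.mono Icc_subset_Ici_self).neg.sup continuousOn_const
  have hbdd : BddAbove (f '' Icc 0 b) := (isCompact_Icc.image_of_continuousOn hfc).bddAbove
  have le_v : ∀ s t, 0 ≤ s → s ≤ t → t ≤ b → f s ≤ v t := fun s t hs hst htb => by
    rw [hv]
    exact le_csSup (hbdd.mono (image_mono (Icc_subset_Icc_right htb))) (mem_image_of_mem f ⟨hs, hst⟩)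
  have v_le : ∀ t, 0 ≤ t → t ≤ b → v t ≤ v b := fun t ht htb => by
    rw [hv t, hv b]
    exact csSup_le_csSup hbdd ((nonempty_Icc.2 ht).image f)
      (image_mono (Icc_subset_Icc_right htb))
  refine le_antisymm ?_ (v_le a ha hab)
  obtain ⟨t, ⟨ht0, htb⟩, hvt⟩ := isCompact_Icc.exists_sSup_image_eq (nonempty_Icc.2 hb) hfc
  rw [← hv b] at hvt
  rcases le_total t a with hta | hat
  · exact hvt.trans_le (le_v t a ht0 hta hab)
  · have hwt := hpos t ⟨hat, htb⟩
    rw [hw] at hwt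
    have hft : f t = 0 := max_eq_right (by
      by_contra! hneg
      have : f t = -u t := max_eq_left hneg.le
      linarith [v_le t ht0 htb])
    have hfa : 0 ≤ f a := le_max_right _ _
    linarith [le_v a a ha le_rfl hab]
end

section
/- Let u : [0,∞) → ℝ be continuous with u(0) ≥ 0. Suppose v₁ : [0,∞) → ℝ is continuous and nondecreasing with v₁(0) = 0, that w₁(t) := u(t) + v₁(t) ≥ 0 for all t ≥ 0, and that for all 0 ≤ a ≤ b, if w₁(s) > 0 for every s ∈ [a,b] then v₁(b) = v₁(a). Then v₁(t) = sup_{s ∈ [0,t]} max(−u(s), 0) for every t ≥ 0; i.e., the regulator satisfying these properties is unique. -/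
open Set

/-- **Uniqueness of the Skorohod regulator.**
Let `u : [0,∞) → ℝ` be continuous with `u 0 ≥ 0`.  Suppose `v₁` is continuous
and nondecreasing on `[0,∞)` with `v₁ 0 = 0`, that `w₁ t = u t + v₁ t ≥ 0`
for all `t ≥ 0`, and that `v₁` is constant on every interval `[a,b] ⊆ [0,∞)`
on which `w₁` is strictly positive.  Then
`v₁ t = sup_{s ∈ [0,t]} max (−u s) 0` for every `t ≥ 0`. -/
theorem skorohod_regulator_unique
    (u v₁ w₁ : ℝ → ℝ)
    (hu : ContinuousOn u (Ici 0)) (hu0 : 0 ≤ u 0)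
    (hv₁c : ContinuousOn v₁ (Ici 0)) (hv₁m : MonotoneOn v₁ (Ici 0))
    (hv₁0 : v₁ 0 = 0)
    (hw₁ : ∀ t, w₁ t = u t + v₁ t)
    (hw₁pos : ∀ t, 0 ≤ t → 0 ≤ w₁ t)
    (hflat : ∀ a b, 0 ≤ a → a ≤ b → (∀ s ∈ Icc a b, 0 < w₁ s) → v₁ b = v₁ a) :
    ∀ t, 0 ≤ t → v₁ t = sSup ((fun s => max (-u s) 0) '' Icc 0 t) := by
  intro t ht
  have hsub : Icc 0 t ⊆ Ici (0 : ℝ) := Icc_subset_Ici_self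
  have hv_nonneg : ∀ s, 0 ≤ s → 0 ≤ v₁ s := fun s hs =>
    hv₁0 ▸ hv₁m (mem_Ici.2 le_rfl) (mem_Ici.2 hs) hs
  have hmem : v₁ t ∈ (fun s => max (-u s) 0) '' Icc 0 t := by
    by_cases hne : (Icc 0 t ∩ w₁ ⁻¹' {0}).Nonempty
    · have hw_cont : ContinuousOn w₁ (Icc 0 t) :=
        ((hu.add hv₁c).mono hsub).congr fun s _ => hw₁ s
      have hcompact : IsCompact (Icc 0 t ∩ w₁ ⁻¹' {0}) :=
        isCompact_Icc.of_isClosed_subset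
          (hw_cont.preimage_isClosed_of_isClosed isClosed_Icc isClosed_singleton)
          inter_subset_left
      obtain ⟨a, ⟨ha, hwa⟩, hmax⟩ := hcompact.exists_isGreatest hne
      have hwa : w₁ a = 0 := hwa
      have hva : v₁ t = v₁ a := by
        rcases ha.2.eq_or_lt with rfl | hat
        · rfl
        have hlim : Filter.Tendsto v₁ (nhdsWithin a (Ioi a)) (nhds (v₁ a)) :=
          (hv₁c a ha.1).mono fun s hs => mem_Ici.2 (ha.1.trans (le_of_lt hs))
        have heq : v₁ =ᶠ[nhdsWithin a (Ioi a)] fun _ => v₁ t := by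
          filter_upwards [Ioc_mem_nhdsGT hat] with b hb
          refine (hflat b t (ha.1.trans hb.1.le) hb.2 fun s hs => ?_).symm
          have has : a < s := hb.1.trans_le hs.1
          have hs0 : 0 ≤ s := ha.1.trans has.le
          exact (hw₁pos s hs0).lt_of_ne' fun h => (hmax ⟨⟨hs0, hs.2⟩, h⟩).not_gt has
        exact tendsto_nhds_unique (tendsto_const_nhds.congr' heq.symm) hlim
      refine ⟨a, ha, ?_⟩
      have hua : -u a = v₁ a := by linarith [hw₁ a]
      simp only [hua, hva, max_eq_left (hv_nonneg a ha.1)]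
    · have hvt : v₁ t = 0 := hv₁0 ▸ hflat 0 t le_rfl ht fun s hs =>
        (hw₁pos s hs.1).lt_of_ne' fun h => hne ⟨s, hs, h⟩
      exact ⟨0, ⟨le_rfl, ht⟩, by simpa [hvt] using hu0⟩
  refine (IsGreatest.csSup_eq ⟨hmem, ?_⟩).symm
  rintro _ ⟨s, hs, rfl⟩
  refine max_le ?_ (hv_nonneg t ht)
  linarith [hw₁ s, hw₁pos s hs.1, hv₁m (hsub hs) (mem_Ici.2 ht) hs.2]
end
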